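/- Suppose X₁(0,0) ≠ 0. Let a be a rational function in x₁,x₂ that is defined (pole-free) in a neighborhood of (0,0) and satisfies X(a) = B₀·a + B₁ in a neighborhood of (0,0). Then there exists a first integral ω of X at (0,0) such that η := ∂₂ω is nonvanishing in a neighborhood of (0,0) and satisfies the rational logarithmic-derivative relations X₁·∂₁η = (B₀ − X₂·a)·η and ∂₂η = a·η in that neighborhood. -/

import Mathlib

open Filter MvPolynomial

/-- Evaluation of a polynomial in two variables at a point of `ℂ × ℂ`. -/
noncomputable def pev (P : MvPolynomial (Fin 2) ℂ) (p : ℂ × ℂ) : ℂ :=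
  MvPolynomial.eval ![p.1, p.2] P

/-- Partial derivative with respect to the first variable. -/
noncomputable def d1 : (ℂ × ℂ → ℂ) → (ℂ × ℂ → ℂ) :=
  fun f p => deriv (fun x => f (x, p.2)) p.1

/-- Partial derivative with respect to the second variable. -/
noncomputable def d2 : (ℂ × ℂ → ℂ) → (ℂ × ℂ → ℂ) :=
  fun f p => deriv (fun y => f (p.1, y)) p.2

/-- The differential operator `X(g) = X₁·∂₁g + X₂·∂₂g`. -/
noncomputable def Xop (X₁ X₂ : MvPolynomial (Fin 2) ℂ) (f : ℂ × ℂ → ℂ) : ℂ × ℂ → ℂ :=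
  fun p => pev X₁ p * d1 f p + pev X₂ p * d2 f p

/-- A first integral of `X` at `p`: a nonconstant function, analytic near `p`,
annihilated by `X` near `p`. -/
def IsFirstIntegralAt (X₁ X₂ : MvPolynomial (Fin 2) ℂ) (ω : ℂ × ℂ → ℂ) (p : ℂ × ℂ) : Prop :=
  AnalyticAt ℂ ω p ∧ (∀ᶠ q in nhds p, Xop X₁ X₂ ω q = 0) ∧
    ¬ ∃ c : ℂ, ∀ᶠ q in nhds p, ω q = c

/-- The functions `Bᵢ = −X₁·∂₂^{i+1}(X₂/X₁)`. -/
noncomputable def B (X₁ X₂ : MvPolynomial (Fin 2) ℂ) (i : ℕ) : ℂ × ℂ → ℂ :=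
  fun p => -(pev X₁ p) * (d2^[i + 1] (fun q => pev X₂ q / pev X₁ q)) p

/-- Termwise integration along a segment of the power series of the Fréchet derivative. -/
theorem HasFPowerSeriesOnBall.hasSum_sub_of_hasFDerivAt {E F : Type*} [NormedAddCommGroup E]
    [NormedSpace ℂ E] [NormedAddCommGroup F] [NormedSpace ℂ F] [CompleteSpace F]
    {G : E → F} {G' : E → E →L[ℂ] F} {p : FormalMultilinearSeries ℂ E (E →L[ℂ] F)}
    {x y : E} {r : ENNReal} (hp : HasFPowerSeriesOnBall G' p x r)
    (hd : ∀ z ∈ Metric.eball x r, HasFDerivAt G (G' z) z) (hy : y ∈ Metric.eball (0 : E) r) :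
    HasSum (fun n : ℕ => ((n : ℂ) + 1)⁻¹ • p n (fun _ => y) y) (G (x + y) - G x) := by
  have hmem (t : ℝ) (ht : t ∈ Set.Icc (0 : ℝ) 1) : (t : ℂ) • y ∈ Metric.eball (0 : E) r := by
    rw [Metric.mem_eball, edist_zero_right] at hy ⊢
    refine lt_of_le_of_lt ?_ hy
    rw [enorm_smul]
    refine mul_le_of_le_one_left zero_le ?_
    rw [← ofReal_norm]
    simpa [abs_of_nonneg ht.1] using ht.2
  have hmem' (t : ℝ) (ht : t ∈ Set.Icc (0 : ℝ) 1) :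
      x + (t : ℂ) • y ∈ Metric.eball x r := by
    have := hmem t ht
    rw [Metric.mem_eball, edist_zero_right] at this
    simpa [Metric.mem_eball, edist_eq_enorm_sub] using this
  have hderiv (t : ℝ) (ht : t ∈ Set.Icc (0 : ℝ) 1) :
      HasDerivAt (fun t : ℝ => G (x + (t : ℂ) • y)) (G' (x + (t : ℂ) • y) y) t := by
    have hline : HasDerivAt (fun t : ℝ => x + (t : ℂ) • y) y t := by
      simpa using ((hasDerivAt_id t).ofReal_comp.smul_const y).const_add x
    exact ((hd _ (hmem' t ht)).restrictScalars ℝ).comp_hasDerivAt t hline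
  have hcont : ContinuousOn (fun t : ℝ => G' (x + (t : ℂ) • y) y) (Set.Icc 0 1) := by
    have h1 : ContinuousOn (fun t : ℝ => G' (x + (t : ℂ) • y)) (Set.Icc 0 1) :=
      hp.continuousOn.comp (by fun_prop) hmem'
    exact h1.clm_apply continuousOn_const
  have hFTC : ∫ t in (0 : ℝ)..1, G' (x + (t : ℂ) • y) y = G (x + y) - G x := by
    rw [intervalIntegral.integral_eq_sub_of_hasDerivAt (f := fun t : ℝ => G (x + (t : ℂ) • y))]
    · simp
    · intro t ht
      exact hderiv t (by simpa using ht)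
    · apply ContinuousOn.intervalIntegrable
      simpa using hcont
  have hterm : HasSum (fun n : ℕ => ∫ t in (0 : ℝ)..1, ((t : ℂ) ^ n) • p n (fun _ => y) y)
      (∫ t in (0 : ℝ)..1, G' (x + (t : ℂ) • y) y) := by
    refine intervalIntegral.hasSum_integral_of_dominated_convergence
      (fun n _ => ‖p n (fun _ => y)‖ * ‖y‖) ?_ ?_ ?_ ?_ ?_
    · intro n
      exact Continuous.aestronglyMeasurable (by fun_prop)
    · intro n
      refine MeasureTheory.ae_of_all _ fun t ht => ?_
      rw [Set.uIoc_of_le zero_le_one] at ht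
      rw [norm_smul, norm_pow, Complex.norm_real, Real.norm_of_nonneg ht.1.le]
      exact (mul_le_of_le_one_left (norm_nonneg _) (pow_le_one₀ ht.1.le ht.2)).trans
        ((p n fun _ => y).le_opNorm y)
    · refine MeasureTheory.ae_of_all _ fun t _ => ?_
      exact (p.summable_norm_apply (Metric.eball_subset_eball hp.r_le hy)).mul_right _
    · exact intervalIntegrable_const
    · refine MeasureTheory.ae_of_all _ fun t ht => ?_
      rw [Set.uIoc_of_le zero_le_one] at ht
      have := (ContinuousLinearMap.apply ℂ F y).hasSum (hp.hasSum (hmem t ⟨ht.1.le, ht.2⟩))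
      have hsmul (n : ℕ) : p n (fun _ => (t : ℂ) • y) = (t : ℂ) ^ n • p n fun _ => y := by
        simpa using (p n).map_smul_univ (fun _ => (t : ℂ)) fun _ => y
      simp only [hsmul] at this
      exact this
  have hint (n : ℕ) : ∫ t in (0 : ℝ)..1, ((t : ℂ) ^ n) • p n (fun _ => y) y
      = ((n : ℂ) + 1)⁻¹ • p n (fun _ => y) y := by
    have h1 : ∫ t in (0 : ℝ)..1, (t : ℂ) ^ n = ((n : ℂ) + 1)⁻¹ := by
      have : ∫ t in (0 : ℝ)..1, (t : ℂ) ^ n = ((∫ t in (0 : ℝ)..1, t ^ n : ℝ) : ℂ) := by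
        rw [← intervalIntegral.integral_ofReal]
        simp
      rw [this, integral_pow]
      simp
    rw [intervalIntegral.integral_smul_const, h1]
  rw [← hFTC]
  simpa only [hint] using hterm

open Topology in
/-- A function whose Fréchet derivative is given by an analytic map is analytic. -/
theorem analyticAt_of_eventually_hasFDerivAt {E F : Type*} [NormedAddCommGroup E]
    [NormedSpace ℂ E] [NormedAddCommGroup F] [NormedSpace ℂ F] [CompleteSpace F]
    {G : E → F} {G' : E → E →L[ℂ] F} {x : E} (hG' : AnalyticAt ℂ G' x)
    (hG : ∀ᶠ y in 𝓝 x, HasFDerivAt G (G' y) y) : AnalyticAt ℂ G x := by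
  obtain ⟨p, r₁, hp₁⟩ := hG'
  obtain ⟨r₂, hr₂, hball⟩ := EMetric.mem_nhds_iff.1 hG
  have hp := hp₁.mono (lt_min hp₁.r_pos hr₂) (min_le_left r₁ r₂)
  have hd : ∀ y ∈ Metric.eball x (min r₁ r₂), HasFDerivAt G (G' y) y := fun y hy =>
    hball (Metric.eball_subset_eball (min_le_right r₁ r₂) hy)
  generalize min r₁ r₂ = r at hp hd
  let q : FormalMultilinearSeries ℂ E (E →L[ℂ] F) := fun n => ((n : ℂ) + 1)⁻¹ • p n
  have hq_norm (n : ℕ) : ‖q n‖ ≤ ‖p n‖ := by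
    have h1 : ‖((n : ℂ) + 1)⁻¹‖ ≤ 1 := by
      rw [norm_inv]
      apply inv_le_one_of_one_le₀
      have : ‖((n : ℂ) + 1)‖ = (n : ℝ) + 1 := by
        exact_mod_cast Complex.norm_natCast (n + 1)
      rw [this]
      linarith [n.cast_nonneg (α := ℝ)]
    calc ‖q n‖ = ‖((n : ℂ) + 1)⁻¹‖ * ‖p n‖ := norm_smul ((n : ℂ) + 1)⁻¹ (p n)
      _ ≤ 1 * ‖p n‖ := by gcongr
      _ = ‖p n‖ := one_mul _
  have hq_radius : p.radius ≤ q.radius := by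
    refine ENNReal.le_of_forall_nnreal_lt fun s hs => ?_
    obtain ⟨C, -, hC⟩ := p.norm_mul_pow_le_of_lt_radius hs
    exact q.le_radius_of_bound C fun n =>
      (mul_le_mul_of_nonneg_right (hq_norm n) (by positivity)).trans (hC n)
  refine ⟨q.unshift (G x), r, ?_, hp.r_pos, fun {y} hy => ?_⟩
  · rw [FormalMultilinearSeries.radius_unshift]
    exact hp.r_le.trans hq_radius
  have hG₀ : G (x + y) = q.unshift (G x) 0 (fun _ => y) + (G (x + y) - G x) :=
    (add_sub_cancel (G x) (G (x + y))).symm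
  rw [hG₀]
  exact HasSum.zero_add (hp.hasSum_sub_of_hasFDerivAt hd hy)

theorem hasDerivAt_slice_fst {f : ℂ × ℂ → ℂ} {f' : ℂ × ℂ →L[ℂ] ℂ} {q : ℂ × ℂ}
    (hf : HasFDerivAt f f' q) : HasDerivAt (fun x => f (x, q.2)) (f' (1, 0)) q.1 :=
  HasFDerivAt.comp_hasDerivAt (f := fun x => (x, q.2)) q.1 hf
    ((hasDerivAt_id q.1).prodMk (hasDerivAt_const q.1 q.2))

theorem hasDerivAt_slice_snd {f : ℂ × ℂ → ℂ} {f' : ℂ × ℂ →L[ℂ] ℂ} {q : ℂ × ℂ}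
    (hf : HasFDerivAt f f' q) : HasDerivAt (fun y => f (q.1, y)) (f' (0, 1)) q.2 :=
  HasFDerivAt.comp_hasDerivAt (f := fun y => (q.1, y)) q.2 hf
    ((hasDerivAt_const q.2 q.1).prodMk (hasDerivAt_id q.2))

theorem HasFDerivAt.d1_eq {f : ℂ × ℂ → ℂ} {f' : ℂ × ℂ →L[ℂ] ℂ} {q : ℂ × ℂ}
    (hf : HasFDerivAt f f' q) : d1 f q = f' (1, 0) :=
  (hasDerivAt_slice_fst hf).deriv

theorem HasFDerivAt.d2_eq {f : ℂ × ℂ → ℂ} {f' : ℂ × ℂ →L[ℂ] ℂ} {q : ℂ × ℂ}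
    (hf : HasFDerivAt f f' q) : d2 f q = f' (0, 1) :=
  (hasDerivAt_slice_snd hf).deriv

theorem AnalyticAt.hasDerivAt_d1 {f : ℂ × ℂ → ℂ} {q : ℂ × ℂ} (hf : AnalyticAt ℂ f q) :
    HasDerivAt (fun x => f (x, q.2)) (d1 f q) q.1 :=
  (hasDerivAt_slice_fst hf.differentiableAt.hasFDerivAt).differentiableAt.hasDerivAt

theorem AnalyticAt.hasDerivAt_d2 {f : ℂ × ℂ → ℂ} {q : ℂ × ℂ} (hf : AnalyticAt ℂ f q) :
    HasDerivAt (fun y => f (q.1, y)) (d2 f q) q.2 :=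
  (hasDerivAt_slice_snd hf.differentiableAt.hasFDerivAt).differentiableAt.hasDerivAt

theorem AnalyticAt.d2 {f : ℂ × ℂ → ℂ} {q : ℂ × ℂ} (hf : AnalyticAt ℂ f q) :
    AnalyticAt ℂ (d2 f) q := by
  have h : AnalyticAt ℂ (fun p => fderiv ℂ f p (0, 1)) q :=
    ((ContinuousLinearMap.apply ℂ ℂ ((0, 1) : ℂ × ℂ)).analyticAt _).comp hf.fderiv
  refine h.congr ?_
  filter_upwards [hf.eventually_analyticAt] with p hp
  exact hp.differentiableAt.hasFDerivAt.d2_eq.symm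

theorem Filter.EventuallyEq.d1_eq {f g : ℂ × ℂ → ℂ} {q : ℂ × ℂ} (h : f =ᶠ[nhds q] g) :
    d1 f q = d1 g q := by
  have hc : Tendsto (fun x : ℂ => (x, q.2)) (nhds q.1) (nhds q) :=
    Continuous.tendsto (f := fun x : ℂ => (x, q.2)) (by fun_prop) q.1
  exact (h.comp_tendsto hc).deriv_eq

theorem Filter.EventuallyEq.d2_eq {f g : ℂ × ℂ → ℂ} {q : ℂ × ℂ} (h : f =ᶠ[nhds q] g) :
    d2 f q = d2 g q := by
  have hc : Tendsto (fun y : ℂ => (q.1, y)) (nhds q.2) (nhds q) :=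
    Continuous.tendsto (f := fun y : ℂ => (q.1, y)) (by fun_prop) q.2
  exact (h.comp_tendsto hc).deriv_eq

/-- The Poincaré lemma for germs of holomorphic `1`-forms on `ℂ × ℂ`. -/
theorem exists_analyticAt_d1_d2_eq {u v : ℂ × ℂ → ℂ} {p : ℂ × ℂ} (hu : AnalyticAt ℂ u p)
    (hv : AnalyticAt ℂ v p) (huv : ∀ᶠ q in nhds p, d2 u q = d1 v q) :
    ∃ F : ℂ × ℂ → ℂ, AnalyticAt ℂ F p ∧ ∀ᶠ q in nhds p, d1 F q = u q ∧ d2 F q = v q := by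
  let θ : ℂ × ℂ → ℂ × ℂ →L[ℂ] ℂ := fun q =>
    u q • ContinuousLinearMap.fst ℂ ℂ ℂ + v q • ContinuousLinearMap.snd ℂ ℂ ℂ
  have hθ : AnalyticAt ℂ θ p := (hu.smul analyticAt_const).add (hv.smul analyticAt_const)
  obtain ⟨ε, hε, hball⟩ := Metric.eventually_nhds_iff_ball.1
    (hu.eventually_analyticAt.and (hv.eventually_analyticAt.and huv))
  obtain ⟨F, hF⟩ : ∃ F, ∀ q ∈ Metric.ball p ε, HasFDerivAt F (θ q) q := by
    have hfd (q) (hq : q ∈ Metric.ball p ε) : HasFDerivAt θ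
        ((fderiv ℂ u q).smulRight (ContinuousLinearMap.fst ℂ ℂ ℂ)
          + (fderiv ℂ v q).smulRight (ContinuousLinearMap.snd ℂ ℂ ℂ)) q :=
      ((hball q hq).1.differentiableAt.hasFDerivAt.smul_const _).add
        ((hball q hq).2.1.differentiableAt.hasFDerivAt.smul_const
          (ContinuousLinearMap.snd ℂ ℂ ℂ))
    refine (convex_ball p ε).exists_forall_hasFDerivAt_of_fderiv_symmetric Metric.isOpen_ball
      (fun q hq => ((hfd q hq).restrictScalars ℝ).differentiableAt.differentiableWithinAt)
      fun q hq x y => ?_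
    rw [((hfd q hq).restrictScalars ℝ).fderiv]
    have hclosed : fderiv ℂ u q (0, 1) = fderiv ℂ v q (1, 0) := by
      rw [← (hball q hq).1.differentiableAt.hasFDerivAt.d2_eq,
        ← (hball q hq).2.1.differentiableAt.hasFDerivAt.d1_eq, (hball q hq).2.2]
    have hexp (L : ℂ × ℂ →L[ℂ] ℂ) (z : ℂ × ℂ) : L z = z.1 * L (1, 0) + z.2 * L (0, 1) := by
      have hz : z = z.1 • ((1, 0) : ℂ × ℂ) + z.2 • ((0, 1) : ℂ × ℂ) := by
        ext <;> simp
      conv_lhs => rw [hz]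
      rw [map_add, map_smul, map_smul, smul_eq_mul, smul_eq_mul]
    simp only [ContinuousLinearMap.coe_restrictScalars', add_apply,
      ContinuousLinearMap.smulRight_apply, smul_apply,
      ContinuousLinearMap.coe_fst', ContinuousLinearMap.coe_snd', smul_eq_mul]
    rw [hexp (fderiv ℂ u q) x, hexp (fderiv ℂ u q) y, hexp (fderiv ℂ v q) x,
      hexp (fderiv ℂ v q) y, hclosed]
    ring
  have hFe : ∀ᶠ q in nhds p, HasFDerivAt F (θ q) q :=
    Filter.eventually_of_mem (Metric.ball_mem_nhds p hε) hF
  refine ⟨F, analyticAt_of_eventually_hasFDerivAt hθ hFe, ?_⟩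
  filter_upwards [hFe] with q hq
  rw [hq.d1_eq, hq.d2_eq]
  simp [θ]

theorem analyticAt_pev (P : MvPolynomial (Fin 2) ℂ) (q : ℂ × ℂ) : AnalyticAt ℂ (pev P) q := by
  have h : pev P = fun p : ℂ × ℂ => MvPolynomial.aeval ![p.1, p.2] P := by
    ext p
    rw [pev, MvPolynomial.aeval_eq_eval₂Hom]
    rfl
  rw [h]
  refine AnalyticAt.aeval_mvPolynomial (fun i => ?_) P
  fin_cases i
  · exact analyticAt_fst
  · exact analyticAt_snd

/-- a pole-free rational solution `a = P/Q` of `X(a) = B₀·a + B₁` yields a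
first integral `ω` whose `η = ∂₂ω` is nonvanishing and satisfies
`X₁·∂₁η = (B₀ − X₂·a)·η` and `∂₂η = a·η` near `(0,0)`. -/
theorem stmt_16 (X₁ X₂ : MvPolynomial (Fin 2) ℂ)
    (hX₁ : pev X₁ ((0 : ℂ), (0 : ℂ)) ≠ 0)
    (P Q : MvPolynomial (Fin 2) ℂ) (hQ : pev Q ((0 : ℂ), (0 : ℂ)) ≠ 0)
    (hXa : ∀ᶠ q in nhds ((0 : ℂ), (0 : ℂ)),
      Xop X₁ X₂ (fun r => pev P r / pev Q r) q
        = B X₁ X₂ 0 q * (pev P q / pev Q q) + B X₁ X₂ 1 q) :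
    ∃ ω : ℂ × ℂ → ℂ, IsFirstIntegralAt X₁ X₂ ω ((0 : ℂ), (0 : ℂ)) ∧
      (∀ᶠ q in nhds ((0 : ℂ), (0 : ℂ)), d2 ω q ≠ 0) ∧
      ∀ᶠ q in nhds ((0 : ℂ), (0 : ℂ)),
        pev X₁ q * d1 (d2 ω) q
            = (B X₁ X₂ 0 q - pev X₂ q * (pev P q / pev Q q)) * d2 ω q ∧
        d2 (d2 ω) q = (pev P q / pev Q q) * d2 ω q := by
  set p : ℂ × ℂ := (0, 0)
  set f : ℂ × ℂ → ℂ := fun q => pev X₂ q / pev X₁ q with hf_def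
  set a : ℂ × ℂ → ℂ := fun q => pev P q / pev Q q with ha_def
  have hf : AnalyticAt ℂ f p := (analyticAt_pev X₂ p).div (analyticAt_pev X₁ p) hX₁
  have ha : AnalyticAt ℂ a p := (analyticAt_pev P p).div (analyticAt_pev Q p) hQ
  have hX₁e : ∀ᶠ q in nhds p, pev X₁ q ≠ 0 := (analyticAt_pev X₁ p).continuousAt.eventually_ne hX₁
  have hX₂ : ∀ q, pev X₁ q ≠ 0 → pev X₂ q = pev X₁ q * f q := fun q hq => by
    rw [hf_def]
    field_simp
  have hB₀ : ∀ q, B X₁ X₂ 0 q = -(pev X₁ q) * d2 f q := fun q => rfl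
  have hB₁ : ∀ q, B X₁ X₂ 1 q = -(pev X₁ q) * d2 (d2 f) q := fun q => rfl
  obtain ⟨L, hL, hLd⟩ := exists_analyticAt_d1_d2_eq (u := fun q => -(f q * a q + d2 f q))
    ((hf.mul ha).add hf.d2).neg ha (by
      filter_upwards [hXa, hX₁e, hf.eventually_analyticAt, ha.eventually_analyticAt]
        with q hq hq₁ hfq haq
      have h : d2 (fun q => -(f q * a q + d2 f q)) q
          = -(d2 f q * a q + f q * d2 a q + d2 (d2 f) q) :=
        ((hfq.hasDerivAt_d2.mul haq.hasDerivAt_d2).add hfq.d2.hasDerivAt_d2).neg.deriv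
      rw [h]
      rw [hB₀, hB₁, Xop, hX₂ q hq₁] at hq
      apply mul_left_cancel₀ hq₁
      linear_combination -hq)
  set η : ℂ × ℂ → ℂ := fun q => Complex.exp (L q) with hη_def
  have hη : AnalyticAt ℂ η p := hL.cexp
  have hη₁ : ∀ᶠ q in nhds p, d1 η q = -(f q * a q + d2 f q) * η q := by
    filter_upwards [hLd, hL.eventually_analyticAt] with q hq hLq
    have h : d1 η q = Complex.exp (L q) * d1 L q := hLq.hasDerivAt_d1.cexp.deriv
    rw [h, hq.1, mul_comm]
  have hη₂ : ∀ᶠ q in nhds p, d2 η q = a q * η q := by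
    filter_upwards [hLd, hL.eventually_analyticAt] with q hq hLq
    have h : d2 η q = Complex.exp (L q) * d2 L q := hLq.hasDerivAt_d2.cexp.deriv
    rw [h, hq.2, mul_comm]
  obtain ⟨ω, hω, hωd⟩ := exists_analyticAt_d1_d2_eq (u := fun q => -(f q * η q))
    (hf.mul hη).neg hη (by
      filter_upwards [hη₁, hη₂, hf.eventually_analyticAt, hη.eventually_analyticAt]
        with q hq₁ hq₂ hfq hηq
      have h : d2 (fun q => -(f q * η q)) q = -(d2 f q * η q + f q * d2 η q) :=
        (hfq.hasDerivAt_d2.mul hηq.hasDerivAt_d2).neg.deriv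
      rw [h, hq₁, hq₂]
      ring)
  have hω₂ : d2 ω =ᶠ[nhds p] η := hωd.mono fun q hq => hq.2
  refine ⟨ω, ⟨hω, ?_, ?_⟩, ?_, ?_⟩
  · filter_upwards [hωd, hX₁e] with q hq hq₁
    rw [Xop, hq.1, hq.2, hX₂ q hq₁]
    ring
  · rintro ⟨c, hc⟩
    have h1 : d2 ω p = d2 (fun _ => c) p := Filter.EventuallyEq.d2_eq hc
    have h2 : d2 (fun _ : ℂ × ℂ => c) p = 0 := deriv_const _ _
    exact Complex.exp_ne_zero (L p) (hω₂.eq_of_nhds.symm.trans (h1.trans h2))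
  · filter_upwards [hω₂] with q hq
    rw [hq]
    exact Complex.exp_ne_zero _
  · filter_upwards [hω₂.eventuallyEq_nhds, hη₁, hη₂, hX₁e] with q hq h₁ h₂ hq₁
    rw [hq.d1_eq, hq.d2_eq, hq.eq_of_nhds, h₁, h₂, hB₀, hX₂ q hq₁]
    exact ⟨by ring, rfl⟩
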